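/- arXiv:hep-th/0112096 — 2 statements merged into one kernel-verified Lean document; each statement's English description precedes it below -/
import Mathlib

section
/- Let r ≥ 1 and let L be an M_r(ℂ)-valued function, holomorphic (entrywise) on a punctured neighborhood of a point z₀ ∈ ℂ and with at most a simple pole at z₀, with Laurent expansion L(z) = L₀·(z−z₀)⁻¹ + L₁ + O(z−z₀). Then the following are equivalent: (a) there exist vectors α, β ∈ ℂʳ and a scalar κ ∈ ℂ such that L₀ = β·αᵀ, αᵀβ = 1, and αᵀL₁ = κ·αᵀ; (b) there exist a neighborhood U of z₀ and holomorphic M_r(ℂ)-valued functions Φ and L̃ on U such that det Φ has a zero of order exactly 1 at z₀, det Φ(z) ≠ 0 for z ∈ U \ {z₀}, and L(z) = Φ′(z)·Φ(z)⁻¹ + Φ(z)·L̃(z)·Φ(z)⁻¹ for all z ∈ U \ {z₀}. (Paper's Lemma 2.1: local characterization of the admissible simple poles of a meromorphic connection at the Tyurin points.) -/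
open Filter Topology in
lemma aux_limit {r : ℕ} {z₀ : ℂ} {F G : ℂ → Matrix (Fin r) (Fin r) ℂ}
    (hF : ContinuousAt F z₀) (hG : ContinuousAt G z₀)
    (h : ∀ᶠ z in 𝓝[≠] z₀, F z = G z) : F z₀ = G z₀ := by
  have h1 : Tendsto F (𝓝[≠] z₀) (𝓝 (F z₀)) := hF.tendsto.mono_left nhdsWithin_le_nhds
  have h2 : Tendsto G (𝓝[≠] z₀) (𝓝 (G z₀)) := hG.tendsto.mono_left nhdsWithin_le_nhds
  exact tendsto_nhds_unique (h1.congr' h) h2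

lemma aux_slope {r : ℕ} {z₀ : ℂ} {F : ℂ → Matrix (Fin r) (Fin r) ℂ}
    (hF : ∀ i j, DifferentiableAt ℂ (fun z => F z i j) z₀) :
    ∃ D : ℂ → Matrix (Fin r) (Fin r) ℂ, ContinuousAt D z₀ ∧
      (∀ z, F z = F z₀ + (z - z₀) • D z) ∧
      D z₀ = Matrix.of (fun i j => deriv (fun w => F w i j) z₀) := by
  refine ⟨fun z => Matrix.of fun i j => dslope (fun w => F w i j) z₀ z, ?_, ?_, ?_⟩
  · refine continuousAt_pi.2 fun i => continuousAt_pi.2 fun j => ?_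
    exact continuousAt_dslope_same.2 (hF i j)
  · intro z
    ext i j
    have := sub_smul_dslope (fun w => F w i j) z₀ z
    simp only [smul_eq_mul] at this
    simp [this]
  · ext i j
    simp

lemma aux_det_diff {r : ℕ} {z₀ : ℂ} {F : ℂ → Matrix (Fin r) (Fin r) ℂ}
    (hF : ∀ i j, DifferentiableAt ℂ (fun z => F z i j) z₀) :
    DifferentiableAt ℂ (fun z => (F z).det) z₀ := by
  simp only [Matrix.det_apply']
  fun_prop

lemma aux_adj_diff {r : ℕ} {z₀ : ℂ} {F : ℂ → Matrix (Fin r) (Fin r) ℂ}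
    (hF : ∀ i j, DifferentiableAt ℂ (fun z => F z i j) z₀) (i j : Fin r) :
    DifferentiableAt ℂ (fun z => (F z).adjugate i j) z₀ := by
  simp only [Matrix.adjugate_apply]
  apply aux_det_diff
  intro k l
  by_cases h : k = j
  · subst h; simp
  · simpa [Matrix.updateRow_ne h] using hF k l

lemma aux_kernel {r : ℕ} (A : Matrix (Fin r) (Fin r) ℂ) (i j : Fin r)
    (h : A.adjugate i j ≠ 0) (u : Fin r → ℂ) (hu : Matrix.vecMul u A = 0) (huj : u j = 0) :
    u = 0 := by
  rw [Matrix.adjugate_apply] at h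
  by_contra hne
  apply h
  refine Matrix.exists_vecMul_eq_zero_iff.1 ⟨u, hne, ?_⟩
  ext l
  have := congrFun hu l
  simp only [Matrix.vecMul, dotProduct, Pi.zero_apply] at this ⊢
  rw [← this]
  refine Finset.sum_congr rfl fun k _ => ?_
  by_cases hk : k = j
  · subst hk; simp [huj]
  · rw [Matrix.updateRow_ne hk]

/-- the purely algebraic part of (b) ⇒ (a) -/
lemma aux_alg {r : ℕ} (L₀ L₁ A B C E T : Matrix (Fin r) (Fin r) ℂ) (g : ℂ) (hg : g ≠ 0)
    (hdet : A.det = 0) (h0 : L₀ * A = 0) (h1 : L₀ * B + L₁ * A = B + A * T)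
    (hC : C = A.adjugate) (h2 : A * E + B * C = g • (1 : Matrix (Fin r) (Fin r) ℂ)) :
    ∃ (α β : Fin r → ℂ) (κ : ℂ),
        L₀ = Matrix.of (fun i j => β i * α j) ∧
        (∑ i, α i * β i) = 1 ∧
        (∀ j, (∑ i, α i * L₁ i j) = κ * α j) := by
  have hCA : C * A = 0 := by rw [hC, Matrix.adjugate_mul, hdet, zero_smul]
  have hAC : A * C = 0 := by rw [hC, Matrix.mul_adjugate, hdet, zero_smul]
  have hCne : ∃ i j, C i j ≠ 0 := by
    by_contra hcon
    push Not at hcon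
    have hC0 : C = 0 := by ext i j; exact hcon i j
    rw [hC0, mul_zero, add_zero] at h2
    have h3 := congrArg Matrix.det h2
    rw [Matrix.det_mul, hdet, zero_mul, Matrix.det_smul, Matrix.det_one, mul_one] at h3
    exact pow_ne_zero _ hg h3.symm
  obtain ⟨i, j, hij⟩ := hCne
  -- one-dimensional left kernel
  have key : ∀ u : Fin r → ℂ, Matrix.vecMul u A = 0 → u = (u j / C i j) • C i := by
    intro u hu
    have hrow : Matrix.vecMul (C i) A = 0 := by
      ext l
      exact congrFun (congrFun hCA i) l
    have : u - (u j / C i j) • C i = 0 := by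
      refine aux_kernel A i j (hC ▸ hij) _ ?_ ?_
      · rw [Matrix.sub_vecMul, Matrix.smul_vecMul, hu, hrow]; simp
      · simp [hij]
    exact sub_eq_zero.1 this
  have hCBC : C * B * C = g • C := by
    have := congrArg (fun M => C * M) h2
    simp only [mul_add, ← mul_assoc, hCA, zero_mul, zero_add, Matrix.mul_smul, mul_one] at this
    exact this
  have h4 : C * L₀ * B * C = g • C := by
    have h5 := congrArg (fun M => C * M * C) h1
    simp only [mul_add, add_mul, ← mul_assoc, hCA, zero_mul, add_zero] at h5
    rw [mul_assoc (C * L₁) A C, hAC, mul_zero, add_zero, hCBC] at h5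
    exact h5
  have hL0 : L₀ = Matrix.vecMulVec (fun k => L₀ k j / C i j) (C i) := by
    ext k l
    have := key (L₀ k) (by ext l; exact congrFun (congrFun h0 k) l)
    exact congrFun this l
  have hab : (∑ k, C i k * (L₀ k j / C i j)) = 1 := by
    set s := ∑ k, C i k * (L₀ k j / C i j) with hs
    have hrow : ∀ l, (C * L₀) i l = s * C i l := by
      intro l
      rw [Matrix.mul_apply, hs, Finset.sum_mul]
      refine Finset.sum_congr rfl fun k _ => ?_
      conv_lhs => rw [hL0]
      simp [Matrix.vecMulVec_apply, mul_assoc]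
    have h6 := congrFun (congrFun h4 i) j
    have h7 := congrFun (congrFun hCBC i) j
    rw [mul_assoc, Matrix.mul_apply] at h6 h7
    simp only [hrow, mul_assoc, ← Finset.mul_sum] at h6
    rw [h7] at h6
    simp only [Matrix.smul_apply, smul_eq_mul] at h6
    exact mul_right_cancel₀ (mul_ne_zero hg hij) (by rw [h6, one_mul])
  have hCL : C * L₀ * B = C * L₀ * B := rfl
  have hrow : ∀ l, (C * L₀) i l = C i l := by
    intro l
    rw [Matrix.mul_apply, ← one_mul (C i l), ← hab, Finset.sum_mul]
    refine Finset.sum_congr rfl fun k _ => ?_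
    conv_lhs => rw [hL0]
    simp [Matrix.vecMulVec_apply, mul_assoc]
  refine ⟨C i, fun k => L₀ k j / C i j, (C * L₁) i j / C i j, ?_, hab, ?_⟩
  · exact hL0
  · have hk : Matrix.vecMul ((C * L₁) i) A = 0 := by
      have h5 := congrArg (fun M => C * M) h1
      simp only [mul_add, ← mul_assoc, hCA, zero_mul, add_zero] at h5
      ext l
      have h6 := congrFun (congrFun h5 i) l
      have h7 : (C * L₀ * B) i l = (C * B) i l := by
        rw [Matrix.mul_apply, Matrix.mul_apply]
        simp only [hrow]
      rw [Matrix.add_apply, h7] at h6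
      exact add_eq_left.1 h6
    intro l
    have := congrFun (key _ hk) l
    rw [Matrix.mul_apply] at this
    exact this

open Filter Topology in
lemma aux_ba (r : ℕ) (z₀ : ℂ) (V : Set ℂ) (hVopen : IsOpen V) (hz₀ : z₀ ∈ V)
    (L R : ℂ → Matrix (Fin r) (Fin r) ℂ)
    (L₀ L₁ : Matrix (Fin r) (Fin r) ℂ)
    (hR : ∀ i j, DifferentiableOn ℂ (fun z => R z i j) V)
    (hLaurent : ∀ z ∈ V \ {z₀},
      L z = (z - z₀)⁻¹ • L₀ + L₁ + (z - z₀) • R z)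
    (U : Set ℂ) (hU : IsOpen U) (hzU : z₀ ∈ U)
    (Φ Lt : ℂ → Matrix (Fin r) (Fin r) ℂ)
    (hΦ : ∀ i j, DifferentiableOn ℂ (fun z => Φ z i j) U)
    (hLt : ∀ i j, DifferentiableOn ℂ (fun z => Lt z i j) U)
    (g : ℂ → ℂ) (hg : DifferentiableOn ℂ g U) (hg0 : g z₀ ≠ 0)
    (hdet : ∀ z ∈ U, (Φ z).det = (z - z₀) * g z)
    (hdetne : ∀ z ∈ U \ {z₀}, (Φ z).det ≠ 0)
    (hLΦ : ∀ z ∈ U \ {z₀},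
          L z = Matrix.of (fun i j => deriv (fun w => Φ w i j) z) * (Φ z)⁻¹
                + Φ z * Lt z * (Φ z)⁻¹) :
    ∃ (α β : Fin r → ℂ) (κ : ℂ),
        L₀ = Matrix.of (fun i j => β i * α j) ∧
        (∑ i, α i * β i) = 1 ∧
        (∀ j, (∑ i, α i * L₁ i j) = κ * α j) := by
  have hUn := hU.mem_nhds hzU
  have hVn := hVopen.mem_nhds hz₀
  have hΦd : ∀ i j, DifferentiableAt ℂ (fun z => Φ z i j) z₀ :=
    fun i j => (hΦ i j).differentiableAt hUn
  have cpi : ∀ F : ℂ → Matrix (Fin r) (Fin r) ℂ,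
      (∀ i j, ContinuousAt (fun z => F z i j) z₀) → ContinuousAt F z₀ := fun F h =>
    continuousAt_pi.2 fun i => continuousAt_pi.2 fun j => h i j
  have cΦ : ContinuousAt Φ z₀ := cpi _ fun i j => (hΦd i j).continuousAt
  have cLt : ContinuousAt Lt z₀ :=
    cpi _ fun i j => ((hLt i j).differentiableAt hUn).continuousAt
  have cR : ContinuousAt R z₀ :=
    cpi _ fun i j => ((hR i j).differentiableAt hVn).continuousAt
  have cg : ContinuousAt g z₀ := (hg.differentiableAt hUn).continuousAt
  have cdPhi : ContinuousAt (fun z => Matrix.of (fun i j => deriv (fun w => Φ w i j) z)) z₀ :=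
    cpi _ fun i j => (((hΦ i j).deriv hU).differentiableAt hUn).continuousAt
  set dPhi : ℂ → Matrix (Fin r) (Fin r) ℂ :=
    fun z => Matrix.of (fun i j => deriv (fun w => Φ w i j) z) with hdPhi
  have ct : ContinuousAt (fun z : ℂ => z - z₀) z₀ := by fun_prop
  obtain ⟨D, cD, hD, hD0⟩ := aux_slope hΦd
  obtain ⟨E, cE, hE, -⟩ := aux_slope (F := fun z => (Φ z).adjugate) (aux_adj_diff hΦd)
  have ev : ∀ᶠ z in 𝓝[≠] z₀, z ∈ U ∧ z ∈ V ∧ z ≠ z₀ := by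
    filter_upwards [nhdsWithin_le_nhds hUn, nhdsWithin_le_nhds hVn, self_mem_nhdsWithin]
      with z h1 h2 h3 using ⟨h1, h2, h3⟩
  have hdet0 : (Φ z₀).det = 0 := by rw [hdet z₀ hzU]; simp
  -- L Φ = dPhi + Φ Lt
  have hmain : ∀ z, z ∈ U → z ∈ V → z ≠ z₀ →
      L₀ * Φ z + (z - z₀) • (L₁ * Φ z + (z - z₀) • (R z * Φ z))
        = (z - z₀) • (dPhi z + Φ z * Lt z) := by
    intro z hz hzV hne
    have ht : z - z₀ ≠ 0 := sub_ne_zero.2 hne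
    have hu : IsUnit (Φ z).det := (hdetne z ⟨hz, hne⟩).isUnit
    have h1 : L z * Φ z = dPhi z + Φ z * Lt z := by
      rw [hLΦ z ⟨hz, hne⟩, add_mul, mul_assoc, mul_assoc (Φ z * Lt z),
        Matrix.nonsing_inv_mul _ hu, mul_one, mul_one]
    rw [← h1, hLaurent z ⟨hzV, hne⟩]
    simp only [add_mul, smul_add, Matrix.smul_mul, smul_smul, mul_inv_cancel₀ ht, one_smul,
      add_assoc]
  have h0 : L₀ * Φ z₀ = 0 := by
    have := aux_limit (z₀ := z₀)
      (F := fun z => L₀ * Φ z + (z - z₀) • (L₁ * Φ z + (z - z₀) • (R z * Φ z)))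
      (G := fun z => (z - z₀) • (dPhi z + Φ z * Lt z))
      (by fun_prop) (by fun_prop)
      (ev.mono fun z hz => hmain z hz.1 hz.2.1 hz.2.2)
    simpa using this
  have h1 : L₀ * D z₀ + L₁ * Φ z₀ = D z₀ + Φ z₀ * Lt z₀ := by
    have := aux_limit (z₀ := z₀)
      (F := fun z => L₀ * D z + (L₁ * Φ z + (z - z₀) • (R z * Φ z)))
      (G := fun z => (dPhi z + Φ z * Lt z))
      (by fun_prop) (by fun_prop)
      (ev.mono fun z hz => by
        have ht : z - z₀ ≠ 0 := sub_ne_zero.2 hz.2.2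
        have h3 := hmain z hz.1 hz.2.1 hz.2.2
        have h4 : L₀ * Φ z = (z - z₀) • (L₀ * D z) := by
          rw [hD z, mul_add, h0, zero_add, Matrix.mul_smul]
        rw [h4, ← smul_add] at h3
        exact smul_right_injective _ ht h3)
    simp only [sub_self, zero_smul, add_zero] at this
    rw [this, hD0]
  have h2 : Φ z₀ * E z₀ + D z₀ * (Φ z₀).adjugate
      = g z₀ • (1 : Matrix (Fin r) (Fin r) ℂ) := by
    have := aux_limit (z₀ := z₀)
      (F := fun z => Φ z₀ * E z + D z * (Φ z₀).adjugate + (z - z₀) • (D z * E z))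
      (G := fun z => g z • (1 : Matrix (Fin r) (Fin r) ℂ))
      (by fun_prop) (by fun_prop)
      (ev.mono fun z hz => by
        have ht : z - z₀ ≠ 0 := sub_ne_zero.2 hz.2.2
        have h3 := Matrix.mul_adjugate (Φ z)
        have h5 : Φ z₀ * (Φ z₀).adjugate = 0 := by
          rw [Matrix.mul_adjugate, hdet0, zero_smul]
        have hEz : (Φ z).adjugate = _ := hE z
        rw [hdet z hz.1, hEz, mul_smul] at h3
        rw [hD z, mul_add, add_mul, add_mul, h5, zero_add] at h3
        simp only [Matrix.smul_mul, Matrix.mul_smul, ← smul_add] at h3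
        have h6 := smul_right_injective _ ht h3
        rw [← h6]
        abel)
    simpa using this
  exact aux_alg L₀ L₁ (Φ z₀) (D z₀) _ (E z₀) (Lt z₀) (g z₀) hg0 hdet0 h0 h1 rfl h2

lemma aux_ab (r : ℕ) (z₀ : ℂ) (V : Set ℂ)
    (L R : ℂ → Matrix (Fin r) (Fin r) ℂ)
    (L₀ L₁ : Matrix (Fin r) (Fin r) ℂ)
    (hR : ∀ i j, DifferentiableOn ℂ (fun z => R z i j) V)
    (hLaurent : ∀ z ∈ V \ {z₀},
      L z = (z - z₀)⁻¹ • L₀ + L₁ + (z - z₀) • R z)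
    (α β : Fin r → ℂ) (κ : ℂ)
    (hL₀ : L₀ = Matrix.of (fun i j => β i * α j))
    (hαβ : (∑ i, α i * β i) = 1)
    (hκ : ∀ j, (∑ i, α i * L₁ i j) = κ * α j) :
      ∃ Φ Lt : ℂ → Matrix (Fin r) (Fin r) ℂ,
        (∀ i j, DifferentiableOn ℂ (fun z => Φ z i j) V) ∧
        (∀ i j, DifferentiableOn ℂ (fun z => Lt z i j) V) ∧
        (∃ g : ℂ → ℂ, DifferentiableOn ℂ g V ∧ g z₀ ≠ 0 ∧
          ∀ z ∈ V, (Φ z).det = (z - z₀) * g z) ∧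
        (∀ z ∈ V \ {z₀}, (Φ z).det ≠ 0) ∧
        (∀ z ∈ V \ {z₀},
          L z = Matrix.of (fun i j => deriv (fun w => Φ w i j) z) * (Φ z)⁻¹
                + Φ z * Lt z * (Φ z)⁻¹) := by
  have hPP : L₀ * L₀ = L₀ := by
    rw [hL₀]
    ext i j
    simp only [Matrix.mul_apply, Matrix.of_apply]
    calc ∑ k, β i * α k * (β k * α j) = β i * α j * ∑ k, α k * β k := by
          rw [Finset.mul_sum]; exact Finset.sum_congr rfl fun k _ => by ring
      _ = _ := by rw [hαβ, mul_one]
  have hPL : L₀ * L₁ = κ • L₀ := by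
    rw [hL₀]
    ext i j
    simp only [Matrix.mul_apply, Matrix.of_apply, Matrix.smul_apply, smul_eq_mul]
    calc ∑ k, β i * α k * L₁ k j = β i * ∑ k, α k * L₁ k j := by
          rw [Finset.mul_sum]; exact Finset.sum_congr rfl fun k _ => by ring
      _ = _ := by rw [hκ]; ring
  have hdet : ∀ t : ℂ, ((1 - L₀) + t • L₀).det = t := by
    intro t
    have : (1 - L₀) + t • L₀ = 1 + Matrix.vecMulVec ((t - 1) • β) α := by
      rw [hL₀]; ext i j
      simp [Matrix.vecMulVec_apply]; ring
    rw [this, Matrix.vecMulVec_eq Unit, Matrix.det_one_add_replicateCol_mul_replicateRow]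
    have : α ⬝ᵥ β = 1 := hαβ
    simp [this]
  refine ⟨fun z => (1 - L₀) + (z - z₀) • L₀,
    fun z => (1 - L₀) * (L₁ + (z - z₀) • R z) * ((1 - L₀) + (z - z₀) • L₀)
      + L₀ * (L₁ + (z - z₀) • R z) * L₀ + L₀ * R z * (1 - L₀), ?_, ?_,
      ⟨fun _ => 1, differentiableOn_const _, one_ne_zero, ?_⟩, ?_, ?_⟩
  · intro i j
    simp only [Matrix.add_apply, Matrix.smul_apply, smul_eq_mul]
    fun_prop
  · intro i j
    simp only [Matrix.add_apply, Matrix.smul_apply, Matrix.mul_apply, smul_eq_mul]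
    fun_prop
  · intro z _
    rw [hdet, mul_one]
  · intro z hz
    rw [hdet]
    exact sub_ne_zero.2 hz.2
  · intro z hz
    have ht : z - z₀ ≠ 0 := sub_ne_zero.2 hz.2
    have hder : Matrix.of (fun i j => deriv (fun w => ((1 - L₀) + (w - z₀) • L₀) i j) z) = L₀ := by
      ext i j
      simp only [Matrix.add_apply, Matrix.smul_apply, smul_eq_mul, Matrix.of_apply]
      have : HasDerivAt (fun w => (1 - L₀) i j + (w - z₀) * L₀ i j) (1 * L₀ i j) z :=
        (((hasDerivAt_id z).sub_const z₀).mul_const _).const_add _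
      rw [this.deriv, one_mul]
    rw [hder, hLaurent z hz]
    have hu : IsUnit ((1 - L₀) + (z - z₀) • L₀).det := by rw [hdet]; exact ht.isUnit
    set t := z - z₀ with htdef
    set A := (1 - L₀) + t • L₀ with hA
    set M := R z
    rw [← add_mul]
    have hgoal : (t⁻¹ • L₀ + L₁ + t • M) * A = L₀ + A * ((1 - L₀) * (L₁ + t • M) * A
      + L₀ * (L₁ + t • M) * L₀ + L₀ * M * (1 - L₀)) := by
      have e1 : A * (1 - L₀) = 1 - L₀ := by
        rw [hA]; simp only [add_mul, sub_mul, mul_sub, Matrix.smul_mul, mul_one, one_mul, hPP]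
        simp
      have e2 : A * L₀ = t • L₀ := by
        rw [hA]; simp only [add_mul, sub_mul, Matrix.smul_mul, one_mul, hPP]
        simp
      have e3 : L₀ * A = t • L₀ := by
        rw [hA]; simp only [mul_add, mul_sub, Matrix.mul_smul, mul_one, hPP]
        simp
      have e4 : L₀ * L₁ * (1 - L₀) = 0 := by
        rw [hPL, Matrix.smul_mul, mul_sub, mul_one, hPP, sub_self, smul_zero]
      have e5 : L₀ * (L₁ + t • M) * A
          = t • (L₀ * (L₁ + t • M) * L₀) + t • (L₀ * M * (1 - L₀)) := by
        rw [hA, mul_add, Matrix.mul_smul, add_comm, mul_add, add_mul (L₀ * L₁) _ (1 - L₀), e4,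
          zero_add, Matrix.mul_smul, Matrix.smul_mul]
      calc (t⁻¹ • L₀ + L₁ + t • M) * A
          = t⁻¹ • (L₀ * A) + ((1 - L₀) * (L₁ + t • M) * A + L₀ * (L₁ + t • M) * A) := by
            rw [add_assoc, add_mul, Matrix.smul_mul, ← add_mul, ← add_mul, sub_add_cancel,
              one_mul]
        _ = _ := by
            rw [e3, smul_smul, inv_mul_cancel₀ ht, one_smul, e5]
            rw [mul_add A, mul_add A, ← mul_assoc A, ← mul_assoc A, ← mul_assoc A, ← mul_assoc A,
              ← mul_assoc A, ← mul_assoc A, e1, e2]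
            simp only [Matrix.smul_mul, add_assoc]
    rw [← hgoal, mul_assoc, Matrix.mul_nonsing_inv _ hu, mul_one]


/-- Paper's Lemma 2.1: a matrix-valued function with at most a simple pole at `z₀`
satisfies the Tyurin constraints (rank-one residue `β·αᵀ` with `αᵀβ = 1` and
`αᵀL₁ = κ·αᵀ`) if and only if it factors locally as
`L = Φ′·Φ⁻¹ + Φ·L̃·Φ⁻¹` with `Φ, L̃` holomorphic and `det Φ` having a simple zero at `z₀`. -/
theorem stmt_0 (r : ℕ) (hr : 1 ≤ r) (z₀ : ℂ) (V : Set ℂ) (hVopen : IsOpen V) (hz₀ : z₀ ∈ V)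
    (L R : ℂ → Matrix (Fin r) (Fin r) ℂ)
    (L₀ L₁ : Matrix (Fin r) (Fin r) ℂ)
    (hL : ∀ i j, DifferentiableOn ℂ (fun z => L z i j) (V \ {z₀}))
    (hR : ∀ i j, DifferentiableOn ℂ (fun z => R z i j) V)
    (hLaurent : ∀ z ∈ V \ {z₀},
      L z = (z - z₀)⁻¹ • L₀ + L₁ + (z - z₀) • R z) :
    (∃ (α β : Fin r → ℂ) (κ : ℂ),
        L₀ = Matrix.of (fun i j => β i * α j) ∧
        (∑ i, α i * β i) = 1 ∧
        (∀ j, (∑ i, α i * L₁ i j) = κ * α j))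
    ↔
    (∃ U : Set ℂ, IsOpen U ∧ z₀ ∈ U ∧
      ∃ Φ Lt : ℂ → Matrix (Fin r) (Fin r) ℂ,
        (∀ i j, DifferentiableOn ℂ (fun z => Φ z i j) U) ∧
        (∀ i j, DifferentiableOn ℂ (fun z => Lt z i j) U) ∧
        (∃ g : ℂ → ℂ, DifferentiableOn ℂ g U ∧ g z₀ ≠ 0 ∧
          ∀ z ∈ U, (Φ z).det = (z - z₀) * g z) ∧
        (∀ z ∈ U \ {z₀}, (Φ z).det ≠ 0) ∧
        (∀ z ∈ U \ {z₀},
          L z = Matrix.of (fun i j => deriv (fun w => Φ w i j) z) * (Φ z)⁻¹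
                + Φ z * Lt z * (Φ z)⁻¹)) := by
  constructor
  · rintro ⟨α, β, κ, h1, h2, h3⟩
    exact ⟨V, hVopen, hz₀, aux_ab r z₀ V L R L₀ L₁ hR hLaurent α β κ h1 h2 h3⟩
  · rintro ⟨U, hU, hzU, Φ, Lt, hΦ, hLt, ⟨g, hg, hg0, hd⟩, hd2, hLΦ⟩
    exact aux_ba r z₀ V hVopen hz₀ L R L₀ L₁ hR hLaurent U hU hzU Φ Lt hΦ hLt g hg hg0 hd hd2 hLΦ
end

section
/- Let r ≥ 1, let I ⊆ ℂ (or ℝ) be open (the z-variable) and U ⊆ ℝ² be open (the parameters u = (u₁, u₂)). Let L, ψ : I × U → M_r(ℂ) be twice continuously differentiable with ψ(z, u) invertible and ∂_z ψ = L ψ, and let g : U → GL_r(ℂ) be differentiable (independent of z). Then, pointwise on I × U: Tr( (ψg)⁻¹ δL ∧ δ(ψg) ) = Tr( ψ⁻¹ δL ∧ δψ ) + Tr( ∂_z(ψ⁻¹ δψ) ∧ δg·g⁻¹ ), where ∂_z(ψ⁻¹ δψ) denotes the matrix-valued 1-form with components ∂_z(ψ⁻¹ ∂_{u₁} ψ)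 and ∂_z(ψ⁻¹ ∂_{u₂} ψ). (This is the cocycle identity (h3)/(h55) showing that the two-form Ω̃ = Tr(ψ⁻¹ δL̃ ∧ δψ) changes by a total z-derivative under ψ ↦ ψg with constant-in-z g, which makes the symplectic form ω well defined.) -/
/-- Partial derivative in the first parameter `u₁` of a matrix-valued map on `ℝ²`,
computed entrywise. -/
noncomputable def mpd1 {r : ℕ} (X : ℝ × ℝ → Matrix (Fin r) (Fin r) ℂ) (u : ℝ × ℝ) :
    Matrix (Fin r) (Fin r) ℂ :=
  Matrix.of fun i j => deriv (fun s => X (s, u.2) i j) u.1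

/-- Partial derivative in the second parameter `u₂` of a matrix-valued map on `ℝ²`,
computed entrywise. -/
noncomputable def mpd2 {r : ℕ} (X : ℝ × ℝ → Matrix (Fin r) (Fin r) ℂ) (u : ℝ × ℝ) :
    Matrix (Fin r) (Fin r) ℂ :=
  Matrix.of fun i j => deriv (fun s => X (u.1, s) i j) u.2

/-- The scalar `Tr(α ∧ β) = Tr(α₁β₂ − α₂β₁)` for matrix-valued 1-forms
`α = (α₁, α₂)`, `β = (β₁, β₂)` on `ℝ²`. -/
noncomputable def wedgeTr {r : ℕ} (α₁ α₂ β₁ β₂ : Matrix (Fin r) (Fin r) ℂ) : ℂ :=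
  (α₁ * β₂ - α₂ * β₁).trace

open Topology Filter

/-- Entrywise derivative of a matrix-valued curve. -/
def MHD {r : ℕ} (A : ℝ → Matrix (Fin r) (Fin r) ℂ) (A' : Matrix (Fin r) (Fin r) ℂ) (t : ℝ) : Prop :=
  ∀ i j, HasDerivAt (fun s => A s i j) (A' i j) t

theorem MHD.mul {r : ℕ} {A B : ℝ → Matrix (Fin r) (Fin r) ℂ} {A' B' : Matrix (Fin r) (Fin r) ℂ}
    {t : ℝ} (hA : MHD A A' t) (hB : MHD B B' t) :
    MHD (fun s => A s * B s) (A' * B t + A t * B') t := by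
  intro i j
  simp only [Matrix.mul_apply, Matrix.add_apply, ← Finset.sum_add_distrib]
  exact HasDerivAt.fun_sum fun k _ => (hA i k).mul (hB k j)

theorem MHD.unique {r : ℕ} {A : ℝ → Matrix (Fin r) (Fin r) ℂ} {A' B' : Matrix (Fin r) (Fin r) ℂ}
    {t : ℝ} (hA : MHD A A' t) (hB : MHD A B' t) : A' = B' := by
  ext i j
  exact (hA i j).unique (hB i j)

theorem MHD.congr {r : ℕ} {A B : ℝ → Matrix (Fin r) (Fin r) ℂ} {A' : Matrix (Fin r) (Fin r) ℂ}
    {t : ℝ} (hA : MHD A A' t) (h : ∀ᶠ s in 𝓝 t, B s = A s) : MHD B A' t := by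
  intro i j
  exact (hA i j).congr_of_eventuallyEq (h.mono fun s hs => by simp only [hs])

theorem MHD.of_eq {r : ℕ} {A : ℝ → Matrix (Fin r) (Fin r) ℂ} {A' : Matrix (Fin r) (Fin r) ℂ}
    {t : ℝ} (hA : MHD A A' t) : Matrix.of (fun i j => deriv (fun s => A s i j) t) = A' := by
  ext i j
  exact (hA i j).deriv

theorem diff_det {r : ℕ} {A : ℝ → Matrix (Fin r) (Fin r) ℂ} {t : ℝ}
    (h : ∀ i j, DifferentiableAt ℝ (fun s => A s i j) t) :
    DifferentiableAt ℝ (fun s => (A s).det) t := by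
  simp only [Matrix.det_apply']
  refine DifferentiableAt.fun_sum fun σ _ => ?_
  refine DifferentiableAt.const_mul ?_ _
  exact DifferentiableAt.fun_finsetProd fun i _ => h _ _

theorem diff_inv {r : ℕ} {A : ℝ → Matrix (Fin r) (Fin r) ℂ} {t : ℝ}
    (h : ∀ i j, DifferentiableAt ℝ (fun s => A s i j) t) (hu : IsUnit (A t)) :
    ∀ i j, DifferentiableAt ℝ (fun s => (A s)⁻¹ i j) t := by
  intro i j
  simp only [Matrix.inv_def, Matrix.smul_apply, Ring.inverse_eq_inv', smul_eq_mul,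
    Matrix.adjugate_apply]
  refine DifferentiableAt.mul ((diff_det h).inv ?_) (diff_det ?_)
  · exact ((Matrix.isUnit_iff_isUnit_det _).1 hu).ne_zero
  · intro a b
    by_cases hab : a = j
    · subst hab; simp
    · simpa [Matrix.updateRow_apply, hab] using h a b

theorem MHD.inv {r : ℕ} {A : ℝ → Matrix (Fin r) (Fin r) ℂ} {A' : Matrix (Fin r) (Fin r) ℂ}
    {t : ℝ} (hA : MHD A A' t) (hu : ∀ᶠ s in 𝓝 t, IsUnit (A s)) :
    MHD (fun s => (A s)⁻¹) (-((A t)⁻¹ * A' * (A t)⁻¹)) t := by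
  have hd := diff_inv (fun i j => (hA i j).differentiableAt) hu.self_of_nhds
  obtain ⟨B', hB⟩ : ∃ B', MHD (fun s => (A s)⁻¹) B' t :=
    ⟨Matrix.of fun i j => deriv (fun s => (A s)⁻¹ i j) t, fun i j => (hd i j).hasDerivAt⟩
  have h1 : MHD (fun s => (A s)⁻¹ * A s) 0 t := by
    have : MHD (fun _ => (1 : Matrix (Fin r) (Fin r) ℂ)) 0 t := fun i j => hasDerivAt_const _ _
    refine this.congr (hu.mono fun s hs => ?_)
    exact Matrix.nonsing_inv_mul _ ((Matrix.isUnit_iff_isUnit_det _).1 hs)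
  have h2 := (hB.mul hA).unique h1
  have h3 : A t * (A t)⁻¹ = 1 :=
    Matrix.mul_nonsing_inv _ ((Matrix.isUnit_iff_isUnit_det _).1 hu.self_of_nhds)
  have : B' = -((A t)⁻¹ * A' * (A t)⁻¹) := by
    calc B' = B' * (A t * (A t)⁻¹) := by rw [h3, mul_one]
      _ = (B' * A t) * (A t)⁻¹ := by rw [mul_assoc]
      _ = _ := by rw [eq_neg_of_add_eq_zero_left h2, neg_mul]
  exact this ▸ hB

theorem mixed {F : ℝ × ℝ → ℂ} {z t : ℝ} (hF : ContDiffAt ℝ 2 F (z, t)) :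
    HasDerivAt (fun z' => deriv (fun s => F (z', s)) t)
      (deriv (fun s => deriv (fun z' => F (z', s)) z) t) z := by
  have hev : ∀ᶠ p in 𝓝 (z, t), DifferentiableAt ℝ F p :=
    (hF.eventually (by simp)).mono fun p hp => hp.differentiableAt (by simp)
  have hz : ∀ a b : ℝ, HasDerivAt (fun x : ℝ => (x, b)) ((1 : ℝ), (0 : ℝ)) a := fun a b =>
    (hasDerivAt_id a).prodMk (hasDerivAt_const a b)
  have ht : ∀ a b : ℝ, HasDerivAt (fun x : ℝ => (a, x)) ((0 : ℝ), (1 : ℝ)) b := fun a b =>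
    (hasDerivAt_const b a).prodMk (hasDerivAt_id b)
  have hD : HasFDerivAt (fderiv ℝ F) (fderiv ℝ (fderiv ℝ F) (z, t)) (z, t) :=
    ((hF.fderiv_right (m := 1) (by norm_num)).differentiableAt (by simp)).hasFDerivAt
  have e1 : (fun z' => deriv (fun s => F (z', s)) t) =ᶠ[𝓝 z]
      fun z' => fderiv ℝ F (z', t) (0, 1) := by
    have := (hz z t).continuousAt.eventually hev
    filter_upwards [this] with x hx
    exact (hx.hasFDerivAt.comp_hasDerivAt t (ht x t)).deriv
  have e2 : (fun s => deriv (fun z' => F (z', s)) z) =ᶠ[𝓝 t]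
      fun s => fderiv ℝ F (z, s) (1, 0) := by
    have := (ht z t).continuousAt.eventually hev
    filter_upwards [this] with x hx
    exact (hx.hasFDerivAt.comp_hasDerivAt z (hz z x)).deriv
  have d1 : HasDerivAt (fun z' => fderiv ℝ F (z', t) (0, 1))
      (fderiv ℝ (fderiv ℝ F) (z, t) (1, 0) (0, 1)) z := by
    exact (ContinuousLinearMap.apply ℝ ℂ ((0 : ℝ), (1 : ℝ))).hasFDerivAt.comp_hasDerivAt z
      (hD.comp_hasDerivAt z (hz z t))
  have d2 : HasDerivAt (fun s => fderiv ℝ F (z, s) (1, 0))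
      (fderiv ℝ (fderiv ℝ F) (z, t) (0, 1) (1, 0)) t := by
    exact (ContinuousLinearMap.apply ℝ ℂ ((1 : ℝ), (0 : ℝ))).hasFDerivAt.comp_hasDerivAt t
      (hD.comp_hasDerivAt t (ht z t))
  have hs : IsSymmSndFDerivAt ℝ F (z, t) := hF.isSymmSndFDerivAt (by simp)
  rw [e2.deriv_eq, d2.deriv, hs.eq]
  exact d1.congr_of_eventuallyEq e1

theorem key {r : ℕ} {Λ Ψ : ℝ → ℝ → Matrix (Fin r) (Fin r) ℂ} {z t : ℝ}
    (hΛ : ∀ i j, ContDiffAt ℝ 2 (fun p : ℝ × ℝ => Λ p.1 p.2 i j) (z, t))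
    (hΨ : ∀ i j, ContDiffAt ℝ 2 (fun p : ℝ × ℝ => Ψ p.1 p.2 i j) (z, t))
    (hu : ∀ᶠ x in 𝓝 z, IsUnit (Ψ x t))
    (hode : ∀ᶠ s in 𝓝 t, Matrix.of (fun i j => deriv (fun z' => Ψ z' s i j) z) = Λ z s * Ψ z s) :
    Matrix.of (fun i j => deriv (fun z' =>
      ((Ψ z' t)⁻¹ * Matrix.of (fun i j => deriv (fun s => Ψ z' s i j) t)) i j) z)
    = (Ψ z t)⁻¹ * Matrix.of (fun i j => deriv (fun s => Λ z s i j) t) * Ψ z t := by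
  have hs : ∀ X : ℝ → ℝ → Matrix (Fin r) (Fin r) ℂ,
      (∀ i j, ContDiffAt ℝ 2 (fun p : ℝ × ℝ => X p.1 p.2 i j) (z, t)) →
      MHD (fun s => X z s) (Matrix.of (fun i j => deriv (fun s => X z s i j) t)) t := by
    intro X hX i j
    have : DifferentiableAt ℝ (fun s => X z s i j) t :=
      ((hX i j).differentiableAt (by simp)).comp t
        (f := fun s : ℝ => (z, s)) (by fun_prop)
    exact this.hasDerivAt
  have hz : MHD (fun x => Ψ x t) (Λ z t * Ψ z t) z := by
    rw [← hode.self_of_nhds]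
    intro i j
    have : DifferentiableAt ℝ (fun x => Ψ x t i j) z :=
      ((hΨ i j).differentiableAt (by simp)).comp z
        (f := fun s : ℝ => (s, t)) (by fun_prop)
    exact this.hasDerivAt
  have hm : MHD (fun z' => Matrix.of (fun i j => deriv (fun s => Ψ z' s i j) t))
      (Matrix.of (fun i j => deriv (fun s => (Λ z s * Ψ z s) i j) t)) z := by
    intro i j
    have := mixed (hΨ i j)
    have e : (fun s => deriv (fun z' => Ψ z' s i j) z) =ᶠ[𝓝 t] fun s => (Λ z s * Ψ z s) i j :=
      hode.mono fun s h => congrFun (congrFun h i) j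
    simp only [e.deriv_eq] at this
    exact this
  rw [((hs Λ hΛ).mul (hs Ψ hΨ)).of_eq] at hm
  rw [((hz.inv hu).mul hm).of_eq]
  have h3 : (Ψ z t)⁻¹ * Ψ z t = 1 :=
    Matrix.nonsing_inv_mul _ ((Matrix.isUnit_iff_isUnit_det _).1 hu.self_of_nhds)
  have h4 : Ψ z t * (Ψ z t)⁻¹ = 1 :=
    Matrix.mul_nonsing_inv _ ((Matrix.isUnit_iff_isUnit_det _).1 hu.self_of_nhds)
  generalize Matrix.of (fun i j => deriv (fun s => Ψ z s i j) t) = P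
  rw [show (Ψ z t)⁻¹ * (Λ z t * Ψ z t) * (Ψ z t)⁻¹ = (Ψ z t)⁻¹ * Λ z t by
    rw [← mul_assoc, mul_assoc _ (Ψ z t), h4, mul_one]]
  noncomm_ring

theorem alg {r : ℕ} (p g l1 l2 p1 p2 g1 g2 : Matrix (Fin r) (Fin r) ℂ)
    (hg : IsUnit g) :
    wedgeTr ((p * g)⁻¹ * l1) ((p * g)⁻¹ * l2) (p1 * g + p * g1) (p2 * g + p * g2)
    = wedgeTr (p⁻¹ * l1) (p⁻¹ * l2) p1 p2
      + wedgeTr (p⁻¹ * l1 * p) (p⁻¹ * l2 * p) (g1 * g⁻¹) (g2 * g⁻¹) := by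
  have hgg : g * g⁻¹ = 1 := Matrix.mul_nonsing_inv _ ((Matrix.isUnit_iff_isUnit_det _).1 hg)
  have h : ∀ l q k : Matrix (Fin r) (Fin r) ℂ, ((p * g)⁻¹ * l * (q * g + p * k)).trace =
      (p⁻¹ * l * q).trace + (p⁻¹ * l * p * (k * g⁻¹)).trace := by
    intro l q k
    rw [Matrix.mul_inv_rev, mul_assoc, mul_assoc, Matrix.trace_mul_comm, ← Matrix.trace_add]
    congr 1
    simp only [mul_add, add_mul, mul_assoc, hgg, mul_one]
  simp only [wedgeTr, Matrix.trace_sub, h]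
  ring

/-- The cocycle identity (h3)/(h55) of the paper: under `ψ ↦ ψg` with `g` independent of
`z`, the two-form `Ω̃ = Tr(ψ⁻¹ δL ∧ δψ)` changes by the total `z`-derivative
`Tr(∂_z(ψ⁻¹δψ) ∧ δg·g⁻¹)`. -/
theorem stmt_12 (r : ℕ) (hr : 1 ≤ r)
    (I : Set ℝ) (hI : IsOpen I) (U : Set (ℝ × ℝ)) (hU : IsOpen U)
    (L ψ : ℝ → ℝ × ℝ → Matrix (Fin r) (Fin r) ℂ)
    (g : ℝ × ℝ → Matrix (Fin r) (Fin r) ℂ)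
    (hL : ∀ i j, ContDiffOn ℝ 2 (fun p : ℝ × (ℝ × ℝ) => L p.1 p.2 i j) (I ×ˢ U))
    (hψ : ∀ i j, ContDiffOn ℝ 2 (fun p : ℝ × (ℝ × ℝ) => ψ p.1 p.2 i j) (I ×ˢ U))
    (hg : ∀ i j, DifferentiableOn ℝ (fun u => g u i j) U)
    (hψinv : ∀ z ∈ I, ∀ u ∈ U, IsUnit (ψ z u))
    (hginv : ∀ u ∈ U, IsUnit (g u))
    (hode : ∀ z ∈ I, ∀ u ∈ U,
      Matrix.of (fun i j => deriv (fun z' => ψ z' u i j) z) = L z u * ψ z u) :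
    ∀ z ∈ I, ∀ u ∈ U,
      wedgeTr
        ((ψ z u * g u)⁻¹ * mpd1 (fun v => L z v) u)
        ((ψ z u * g u)⁻¹ * mpd2 (fun v => L z v) u)
        (mpd1 (fun v => ψ z v * g v) u)
        (mpd2 (fun v => ψ z v * g v) u)
      =
      wedgeTr
        ((ψ z u)⁻¹ * mpd1 (fun v => L z v) u)
        ((ψ z u)⁻¹ * mpd2 (fun v => L z v) u)
        (mpd1 (fun v => ψ z v) u)
        (mpd2 (fun v => ψ z v) u)
      +
      wedgeTr
        (Matrix.of (fun i j =>
          deriv (fun z' => ((ψ z' u)⁻¹ * mpd1 (fun v => ψ z' v) u) i j) z))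
        (Matrix.of (fun i j =>
          deriv (fun z' => ((ψ z' u)⁻¹ * mpd2 (fun v => ψ z' v) u) i j) z))
        (mpd1 g u * (g u)⁻¹)
        (mpd2 g u * (g u)⁻¹) := by
  intro z hz u hu
  have hO : IsOpen (I ×ˢ U) := hI.prod hU
  have hmem : I ×ˢ U ∈ 𝓝 (z, u) := hO.mem_nhds ⟨hz, hu⟩
  have huz : ∀ᶠ x in 𝓝 z, IsUnit (ψ x u) :=
    (show ∀ᶠ x in 𝓝 z, x ∈ I from hI.mem_nhds hz).mono fun x hx => hψinv x hx u hu
  have hc1 : Continuous fun s : ℝ => (s, u.2) := by fun_prop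
  have hc2 : Continuous fun s : ℝ => (u.1, s) := by fun_prop
  have hU1 : ∀ᶠ s in 𝓝 u.1, (s, u.2) ∈ U := hc1.continuousAt.eventually (hU.mem_nhds hu)
  have hU2 : ∀ᶠ s in 𝓝 u.2, (u.1, s) ∈ U := hc2.continuousAt.eventually (hU.mem_nhds hu)
  have c1 : ∀ f : ℝ × (ℝ × ℝ) → ℂ, ContDiffOn ℝ 2 f (I ×ˢ U) →
      ContDiffAt ℝ 2 (fun p : ℝ × ℝ => f (p.1, (p.2, u.2))) (z, u.1) := by
    intro f hf
    exact ContDiffAt.comp (z, u.1) (f := fun p : ℝ × ℝ => (p.1, (p.2, u.2)))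
      (hf.contDiffAt hmem) (by fun_prop)
  have c2 : ∀ f : ℝ × (ℝ × ℝ) → ℂ, ContDiffOn ℝ 2 f (I ×ˢ U) →
      ContDiffAt ℝ 2 (fun p : ℝ × ℝ => f (p.1, (u.1, p.2))) (z, u.2) := by
    intro f hf
    exact ContDiffAt.comp (z, u.2) (f := fun p : ℝ × ℝ => (p.1, (u.1, p.2)))
      (hf.contDiffAt hmem) (by fun_prop)
  have k1 := key (Λ := fun x s => L x (s, u.2)) (Ψ := fun x s => ψ x (s, u.2)) (z := z) (t := u.1)
    (fun i j => c1 _ (hL i j)) (fun i j => c1 _ (hψ i j)) huz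
    (hU1.mono fun s hs => hode z hz _ hs)
  have k2 := key (Λ := fun x s => L x (u.1, s)) (Ψ := fun x s => ψ x (u.1, s)) (z := z) (t := u.2)
    (fun i j => c2 _ (hL i j)) (fun i j => c2 _ (hψ i j)) huz
    (hU2.mono fun s hs => hode z hz _ hs)
  have dψ : ∀ i j, DifferentiableAt ℝ (fun v => ψ z v i j) u := fun i j =>
    (((hψ i j).contDiffAt hmem).differentiableAt (by simp)).comp u
      (f := fun v : ℝ × ℝ => (z, v)) (by fun_prop)
  have dg : ∀ i j, DifferentiableAt ℝ (fun v => g v i j) u := fun i j =>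
    (hg i j).differentiableAt (hU.mem_nhds hu)
  have m1 : ∀ X : ℝ × ℝ → Matrix (Fin r) (Fin r) ℂ, (∀ i j, DifferentiableAt ℝ (fun v => X v i j) u) →
      MHD (fun s => X (s, u.2)) (mpd1 X u) u.1 := fun X hX i j =>
    (DifferentiableAt.comp (g := fun v => X v i j) u.1
      (f := fun s : ℝ => (s, u.2)) (hX i j) (by fun_prop)).hasDerivAt
  have m2 : ∀ X : ℝ × ℝ → Matrix (Fin r) (Fin r) ℂ, (∀ i j, DifferentiableAt ℝ (fun v => X v i j) u) →
      MHD (fun s => X (u.1, s)) (mpd2 X u) u.2 := fun X hX i j =>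
    (DifferentiableAt.comp (g := fun v => X v i j) u.2
      (f := fun s : ℝ => (u.1, s)) (hX i j) (by fun_prop)).hasDerivAt
  have p1 : mpd1 (fun v => ψ z v * g v) u = mpd1 (fun v => ψ z v) u * g u + ψ z u * mpd1 g u :=
    ((m1 _ dψ).mul (m1 _ dg)).of_eq
  have p2 : mpd2 (fun v => ψ z v * g v) u = mpd2 (fun v => ψ z v) u * g u + ψ z u * mpd2 g u :=
    ((m2 _ dψ).mul (m2 _ dg)).of_eq
  have k1' : Matrix.of (fun i j =>
          deriv (fun z' => ((ψ z' u)⁻¹ * mpd1 (fun v => ψ z' v) u) i j) z)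
      = (ψ z u)⁻¹ * mpd1 (fun v => L z v) u * ψ z u := k1
  have k2' : Matrix.of (fun i j =>
          deriv (fun z' => ((ψ z' u)⁻¹ * mpd2 (fun v => ψ z' v) u) i j) z)
      = (ψ z u)⁻¹ * mpd2 (fun v => L z v) u * ψ z u := k2
  rw [p1, p2, k1', k2']
  exact alg _ _ _ _ _ _ _ _ (hginv u hu)
end
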